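/- Let U = {(x,y) ∈ ℝ² : y > 0}, V' = {(x,y) ∈ ℝ² : y > 0 and |x| < (1/2)·e^{−1/y}}, and Y = {(x,y) ∈ ℝ² : x = 0 and 0 < y ≤ 1/2}. Then there does not exist a smooth function t : U → ℝ such that (i) for every f ∈ 𝒮(U) the function equal to t·f on U and to 0 outside U belongs to 𝒮(U), (ii) t(p) = 1 for every p ∈ Y, and (iii) t(p) = 0 for every p ∈ U \ V'. -/

import Mathlib

/-- `f ∈ 𝒮(U)` for `U ⊆ ℝ²`: a Schwartz function on `ℝ²` flat at `ℝ² \ U`. -/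
def SchwartzFlatOn (U : Set (ℝ × ℝ)) (f : SchwartzMap (ℝ × ℝ) ℝ) : Prop :=
  ∀ z ∉ U, ∀ k : ℕ, iteratedFDeriv ℝ k (⇑f) z = 0

lemma exists_test : ∃ f : SchwartzMap (ℝ × ℝ) ℝ,
    SchwartzFlatOn {p : ℝ × ℝ | 0 < p.2} f ∧
    ∀ y : ℝ, 0 < y → y ≤ 1 / 2 → f (0, y) = Real.exp (-(2 * y)⁻¹) := by
  let φ : ContDiffBump (0 : ℝ × ℝ) := ⟨1, 2, by norm_num, by norm_num⟩
  let F : ℝ × ℝ → ℝ := fun p => φ p * expNegInvGlue (2 * p.2)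
  have hF : ContDiff ℝ (⊤ : ℕ∞) F :=
    φ.contDiff.mul (expNegInvGlue.contDiff.comp (contDiff_const.mul contDiff_snd))
  have hc : HasCompactSupport F := φ.hasCompactSupport.mul_right
  refine ⟨hc.toSchwartzMap hF, ?_, ?_⟩
  · intro z hz k
    change iteratedFDeriv ℝ k F z = 0
    have hcl : IsClosed {w : ℝ × ℝ | iteratedFDeriv ℝ k F w = 0} :=
      isClosed_eq (hF.continuous_iteratedFDeriv (by exact_mod_cast le_top)) continuous_const
    have hsub : Prod.snd ⁻¹' (Set.Iio (0 : ℝ)) ⊆ {w : ℝ × ℝ | iteratedFDeriv ℝ k F w = 0} := by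
      intro w hw
      have hev : F =ᶠ[nhds w] (fun _ => (0 : ℝ)) := by
        filter_upwards [(isOpen_Iio.preimage continuous_snd).mem_nhds hw] with u hu
        have : 2 * u.2 ≤ 0 := by
          have : u.2 < 0 := hu
          linarith
        simp [F, expNegInvGlue.zero_of_nonpos this]
      have h := (hev.iteratedFDeriv ℝ k).eq_of_nhds
      simpa using h
    have hz' : z ∈ closure (Prod.snd ⁻¹' (Set.Iio (0 : ℝ)) : Set (ℝ × ℝ)) := by
      rw [← isOpenMap_snd.preimage_closure_eq_closure_preimage continuous_snd, closure_Iio]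
      simpa using hz
    exact hcl.closure_subset_iff.2 hsub hz'
  · intro y hy hy2
    change φ (0, y) * expNegInvGlue (2 * y) = _
    have h1 : φ (0, y) = 1 := by
      apply φ.one_of_mem_closedBall
      simp only [Metric.mem_closedBall, dist_zero_right, Prod.norm_mk, norm_zero, Real.norm_eq_abs,
        abs_of_pos hy, φ]
      exact max_le (by norm_num) (by linarith)
    have h2 : ¬ (2 * y ≤ 0) := by linarith
    simp only [h1, expNegInvGlue, h2, if_false, one_mul]

/-- **failure of tempered Urysohn for general open sets.**
With `U = {y > 0}`, `V' = {y > 0, |x| < ½·e^{-1/y}}` and `Y = {x = 0, 0 < y ≤ ½}`,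
there is no smooth tempered function `t` on `U` (i.e. multiplication by `t` followed by
extension by zero preserves `𝒮(U)`) with `t = 1` on `Y` and `t = 0` on `U \ V'`. -/
theorem stmt_12 :
    ¬ ∃ t : ℝ × ℝ → ℝ,
      ContDiffOn ℝ (⊤ : ℕ∞) t {p : ℝ × ℝ | 0 < p.2} ∧
      (∀ f : SchwartzMap (ℝ × ℝ) ℝ, SchwartzFlatOn {p : ℝ × ℝ | 0 < p.2} f →
        ∃ g : SchwartzMap (ℝ × ℝ) ℝ,
          (∀ x ∈ {p : ℝ × ℝ | 0 < p.2}, g x = t x * f x) ∧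
          (∀ x ∉ {p : ℝ × ℝ | 0 < p.2}, g x = 0) ∧
          SchwartzFlatOn {p : ℝ × ℝ | 0 < p.2} g) ∧
      (∀ p ∈ {p : ℝ × ℝ | p.1 = 0 ∧ 0 < p.2 ∧ p.2 ≤ 1 / 2}, t p = 1) ∧
      (∀ p ∈ {p : ℝ × ℝ | 0 < p.2} \
          {p : ℝ × ℝ | 0 < p.2 ∧ |p.1| < (1 / 2) * Real.exp (-1 / p.2)}, t p = 0) := by
  rintro ⟨t, -, hi, hii, hiii⟩
  obtain ⟨f, hf, hfy⟩ := exists_test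
  obtain ⟨g, hg, -, -⟩ := hi f hf
  obtain ⟨C, hC0, hC⟩ := g.decay 0 1
  obtain ⟨n, hn⟩ := exists_nat_gt C
  have hn0 : (0 : ℝ) < n := hC0.trans hn
  have hn1 : (1 : ℝ) ≤ n := by
    have : 0 < n := by exact_mod_cast hn0
    exact_mod_cast this
  have hy0 : (0 : ℝ) < 1 / (2 * n) := by positivity
  have hy1 : 1 / (2 * (n : ℝ)) ≤ 1 / 2 := by
    apply one_div_le_one_div_of_le <;> linarith
  set y : ℝ := 1 / (2 * n) with hy
  have e1 : -(2 * y)⁻¹ = -(n : ℝ) := by rw [hy]; field_simp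
  have e2 : -1 / y = -(n : ℝ) + -(n : ℝ) := by rw [hy]; field_simp; ring
  set x : ℝ := 1 / 2 * Real.exp (-1 / y) with hx
  have hx0 : 0 < x := by positivity
  have g0 : g (0, y) = Real.exp (-(n : ℝ)) := by
    rw [hg (0, y) hy0, hii (0, y) ⟨rfl, hy0, hy1⟩, hfy y hy0 hy1, e1, one_mul]
  have g1 : g (x, y) = 0 := by
    rw [hg (x, y) hy0, hiii (x, y) ⟨hy0, fun h => ?_⟩, zero_mul]
    have h2 := h.2
    simp only [abs_of_pos hx0] at h2
    exact lt_irrefl _ h2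
  have hL := (convex_univ (𝕜 := ℝ) (E := ℝ × ℝ)).norm_image_sub_le_of_norm_fderiv_le (𝕜 := ℝ)
    (f := g) (C := C) (fun p _ => g.differentiableAt)
    (fun p _ => by simpa [norm_iteratedFDeriv_one] using hC p)
    (Set.mem_univ (x, y)) (Set.mem_univ (0, y))
  rw [g0, g1, e2, Real.exp_add] at *
  set s := Real.exp (-(n : ℝ)) with hs
  have hs0 : 0 < s := Real.exp_pos _
  have hd : ‖((0 : ℝ), y) - (x, y)‖ = x := by
    simp [Prod.norm_mk, abs_of_pos hx0, hx0.le]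
  rw [hd, sub_zero, Real.norm_of_nonneg hs0.le, hx] at hL
  have hsn : n * s < 1 := by
    have h1 : (n : ℝ) < Real.exp n := by linarith [Real.add_one_le_exp (n : ℝ)]
    have h2 : Real.exp n * s = 1 := by rw [hs, ← Real.exp_add]; simp
    nlinarith
  have h3 : C * s < 1 := by nlinarith
  nlinarith
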